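/- arXiv:2505.06554 — 3 statements merged into one kernel-verified Lean document; each statement's English description precedes it below -/
import Mathlib

section
/- For every x ≥ 0 and ε > 0: (i) the function t ↦ R^{(x+ε)}(t) − R^{(x)}(t) is non-increasing on [0,∞) and takes values in [−ε, 0]; (ii) the function t ↦ U^{(x+ε)}(t) − U^{(x)}(t) is non-increasing on [0,∞) and takes values in [0, ε]; (iii) the function t ↦ L^{(x+ε)}(t) − L^{(x)}(t) is non-decreasing on [0,∞) and takes values in [0, ε]. -/
open Filter Set

/-- A càdlàg function: right-continuous with left limits. -/
def CadlagFun (f : ℝ → ℝ) : Prop :=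
  (∀ t : ℝ, ContinuousWithinAt f (Set.Ici t) t) ∧
  (∀ t : ℝ, ∃ l : ℝ, Tendsto f (nhdsWithin t (Set.Iio t)) (nhds l))

/-- A strictly increasing sequence of times starting at `0` and tending to `∞`. -/
def IsTimeGrid (T : ℕ → ℝ) : Prop :=
  T 0 = 0 ∧ StrictMono T ∧ Tendsto T atTop atTop

/-- The periodic-classical reflected triple `(U, L, R)` of the path `t ↦ y + f t`:
classical reflection below at level `0`, periodic reflection above at level `a` at the
times `T k`, defined by the recursive specification. -/
structure IsPCTriple (a : ℝ) (T : ℕ → ℝ) (f : ℝ → ℝ) (y : ℝ)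
    (U L R : ℝ → ℝ) : Prop where
  L_first : ∀ t : ℝ, 0 ≤ t → t < T 1 → L t = 0
  R_first : ∀ t : ℝ, 0 ≤ t → t < T 1 →
    R t = max 0 (-sInf ((fun s => y + f s) '' Set.Icc 0 t))
  U_first : ∀ t : ℝ, 0 ≤ t → t < T 1 → U t = y + f t + R t
  R_seg : ∀ (k : ℕ) (t : ℝ), T k < t → t < T (k + 1) →
    R t = R (T k) + max 0 (-sInf ((fun s => U (T k) + f s - f (T k)) '' Set.Icc (T k) t))
  U_seg : ∀ (k : ℕ) (t : ℝ), T k < t → t < T (k + 1) →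
    U t = (U (T k) + f t - f (T k)) + (R t - R (T k))
  L_seg : ∀ (k : ℕ) (t : ℝ), T k < t → t < T (k + 1) → L t = L (T k)
  R_jump : ∀ k : ℕ, R (T (k + 1)) = R (T k) +
    max 0 (-sInf ((fun s => U (T k) + f s - f (T k)) '' Set.Icc (T k) (T (k + 1))))
  L_jump : ∀ k : ℕ, L (T (k + 1)) = L (T k) +
    max (((U (T k) + f (T (k + 1)) - f (T k)) + (R (T (k + 1)) - R (T k))) - a) 0
  U_jump : ∀ k : ℕ, U (T (k + 1)) =
    min ((U (T k) + f (T (k + 1)) - f (T k)) + (R (T (k + 1)) - R (T k))) a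

/-- `τ_0^{(y),-} = inf {t ≥ 0 : y + f t < 0}`, with `inf ∅ = +∞`, as an extended real. -/
noncomputable def tauMinus (f : ℝ → ℝ) (y : ℝ) : EReal :=
  sInf ((fun t : ℝ => (t : EReal)) '' {t : ℝ | 0 ≤ t ∧ y + f t < 0})

/-- `T_a^{(y),+} = inf {T k : k ≥ 1, y + f (T k) > a}`, with `inf ∅ = +∞`. -/
noncomputable def TPlus (a : ℝ) (T : ℕ → ℝ) (f : ℝ → ℝ) (y : ℝ) : EReal :=
  sInf ((fun t : ℝ => (t : EReal)) ''
    {t : ℝ | ∃ k : ℕ, 1 ≤ k ∧ t = T k ∧ a < y + f (T k)})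

theorem CadlagFun.bddBelow_image_Icc {f : ℝ → ℝ} (hf : CadlagFun f) (c d : ℝ) :
    BddBelow (f '' Icc c d) := by
  refine isCompact_Icc.induction_on (p := fun s => BddBelow (f '' s)) (by simp)
    (fun s t hst ht => ht.mono (image_mono hst))
    (fun s t hs ht => by rw [image_union]; exact hs.union ht) fun t _ => ?_
  obtain ⟨l, hl⟩ := hf.2 t
  have hleft : ∀ᶠ s in nhdsWithin t (Iio t), min (l - 1) (f t - 1) < f s :=
    hl.eventually_const_lt ((min_le_left _ _).trans_lt (by linarith))
  have hright : ∀ᶠ s in nhdsWithin t (Ici t), min (l - 1) (f t - 1) < f s :=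
    (hf.1 t).tendsto.eventually_const_lt ((min_le_right _ _).trans_lt (by linarith))
  have hev : ∀ᶠ s in nhds t, min (l - 1) (f t - 1) < f s := by
    rw [← nhdsWithin_univ, ← Iio_union_Ici (a := t), nhdsWithin_union]
    exact eventually_sup.2 ⟨hleft, hright⟩
  refine ⟨_, mem_nhdsWithin_of_mem_nhds hev, min (l - 1) (f t - 1), ?_⟩
  rintro _ ⟨s, hs, rfl⟩
  exact le_of_lt hs

/-- The running infimum of the increments of `f` from time `c` up to time `t`. -/
noncomputable def runInf (f : ℝ → ℝ) (c t : ℝ) : ℝ :=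
  sInf ((fun s => f s - f c) '' Icc c t)

theorem CadlagFun.bddBelow_increments {f : ℝ → ℝ} (hf : CadlagFun f) (c t : ℝ) :
    BddBelow ((fun s => f s - f c) '' Icc c t) := by
  obtain ⟨b, hb⟩ := hf.bddBelow_image_Icc c t
  refine ⟨b - f c, ?_⟩
  rintro _ ⟨s, hs, rfl⟩
  exact sub_le_sub_right (hb (mem_image_of_mem f hs)) _

theorem CadlagFun.runInf_le {f : ℝ → ℝ} (hf : CadlagFun f) {c t : ℝ} (hct : c ≤ t) :
    runInf f c t ≤ f t - f c :=
  csInf_le (hf.bddBelow_increments c t) ⟨t, right_mem_Icc.2 hct, rfl⟩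

theorem CadlagFun.runInf_anti {f : ℝ → ℝ} (hf : CadlagFun f) {c s t : ℝ} (hcs : c ≤ s)
    (hst : s ≤ t) : runInf f c t ≤ runInf f c s :=
  csInf_le_csInf (hf.bddBelow_increments c t) ((nonempty_Icc.2 hcs).image _)
    (image_mono (Icc_subset_Icc_right hst))

theorem runInf_self (f : ℝ → ℝ) (c : ℝ) : runInf f c c = 0 := by
  simp [runInf]

theorem CadlagFun.sInf_shift_eq {f : ℝ → ℝ} (hf : CadlagFun f) (u : ℝ) {c t : ℝ}
    (hct : c ≤ t) :
    sInf ((fun s => u + f s - f c) '' Icc c t) = u + runInf f c t := by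
  have h := (OrderIso.addLeft u).map_csInf' ((nonempty_Icc.2 hct).image _)
    (hf.bddBelow_increments c t)
  rw [image_image] at h
  simp only [OrderIso.addLeft_apply, ← add_sub_assoc] at h
  exact h.symm

section Triple

variable {a : ℝ} {T : ℕ → ℝ} {f : ℝ → ℝ} {y : ℝ} {U L R : ℝ → ℝ}

theorem IsPCTriple.initial (h : IsPCTriple a T f y U L R) (hT : IsTimeGrid T) (hf0 : f 0 = 0)
    (hy : 0 ≤ y) : U (T 0) = y ∧ L (T 0) = 0 ∧ R (T 0) = 0 := by
  have h1 : (0 : ℝ) < T 1 := hT.1 ▸ hT.2.1 Nat.zero_lt_one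
  have hR := h.R_first 0 le_rfl h1
  have hU := h.U_first 0 le_rfl h1
  simp only [Icc_self, image_singleton, csInf_singleton, hf0, add_zero] at hR hU
  rw [max_eq_left (by linarith)] at hR
  rw [hT.1]
  exact ⟨by rw [hU, hR, add_zero], h.L_first 0 le_rfl h1, hR⟩

theorem IsPCTriple.R_jump_eq (h : IsPCTriple a T f y U L R) (hT : IsTimeGrid T)
    (hf : CadlagFun f) (k : ℕ) :
    R (T (k + 1)) = R (T k) + max 0 (-(U (T k) + runInf f (T k) (T (k + 1)))) := by
  rw [h.R_jump k, hf.sInf_shift_eq _ (hT.2.1 k.lt_succ_self).le]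

theorem IsPCTriple.U_grid_nonneg (h : IsPCTriple a T f y U L R) (hT : IsTimeGrid T)
    (hf : CadlagFun f) (hf0 : f 0 = 0) (hy : 0 ≤ y) (ha : 0 ≤ a) (k : ℕ) : 0 ≤ U (T k) := by
  cases k with
  | zero => rw [(h.initial hT hf0 hy).1]; exact hy
  | succ k =>
    rw [h.U_jump k, h.R_jump_eq hT hf k]
    have h1 := hf.runInf_le (hT.2.1 k.lt_succ_self).le
    have h2 := le_max_right 0 (-(U (T k) + runInf f (T k) (T (k + 1))))
    exact le_min (by linarith) ha

theorem IsPCTriple.R_eq (h : IsPCTriple a T f y U L R) (hT : IsTimeGrid T)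
    (hf : CadlagFun f) {k : ℕ} (hU : 0 ≤ U (T k)) {t : ℝ} (ht : t ∈ Icc (T k) (T (k + 1))) :
    R t = R (T k) + max 0 (-(U (T k) + runInf f (T k) t)) := by
  rcases ht.1.eq_or_lt with rfl | h1
  · rw [runInf_self, max_eq_left (by linarith), add_zero]
  rcases ht.2.eq_or_lt with rfl | h2
  · exact h.R_jump_eq hT hf k
  · rw [h.R_seg k t h1 h2, hf.sInf_shift_eq _ h1.le]

theorem IsPCTriple.U_eq (h : IsPCTriple a T f y U L R) {k : ℕ} {t : ℝ}
    (ht : t ∈ Ico (T k) (T (k + 1))) :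
    U t = (U (T k) + f t - f (T k)) + (R t - R (T k)) := by
  rcases ht.1.eq_or_lt with rfl | h1
  · ring
  · exact h.U_seg k t h1 ht.2

theorem IsPCTriple.L_eq (h : IsPCTriple a T f y U L R) {k : ℕ} {t : ℝ}
    (ht : t ∈ Ico (T k) (T (k + 1))) : L t = L (T k) := by
  rcases ht.1.eq_or_lt with rfl | h1
  · rfl
  · exact h.L_seg k t h1 ht.2

end Triple

theorem IsTimeGrid.exists_mem_Ico {T : ℕ → ℝ} (hT : IsTimeGrid T) {t : ℝ} (ht : 0 ≤ t) :
    ∃ k, t ∈ Ico (T k) (T (k + 1)) := by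
  classical
  have hex : ∃ n, t < T n := (hT.2.2.eventually_gt_atTop t).exists
  obtain ⟨k, hk⟩ : ∃ k, Nat.find hex = k + 1 := by
    refine Nat.exists_eq_succ_of_ne_zero fun h0 => ?_
    have := Nat.find_spec hex
    rw [h0, hT.1] at this
    exact this.not_ge ht
  refine ⟨k, not_lt.1 (Nat.find_min hex (by omega)), ?_⟩
  rw [← hk]
  exact Nat.find_spec hex

theorem IsTimeGrid.antitoneOn_Ici {T : ℕ → ℝ} (hT : IsTimeGrid T) {g : ℝ → ℝ}
    (hg : ∀ k, AntitoneOn g (Icc (T k) (T (k + 1)))) : AntitoneOn g (Ici 0) := by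
  have key : ∀ n, AntitoneOn g (Icc 0 (T n)) := by
    intro n
    induction n with
    | zero => rw [hT.1, Icc_self]; exact Set.subsingleton_singleton.antitoneOn g
    | succ n ih =>
      have h0 : 0 ≤ T n := hT.1 ▸ hT.2.1.monotone n.zero_le
      have h1 : T n ≤ T (n + 1) := (hT.2.1 n.lt_succ_self).le
      rw [← Icc_union_Icc_eq_Icc h0 h1]
      exact ih.union_right (hg n) (isGreatest_Icc h0) (isLeast_Icc h1)
  intro s hs t ht hst
  obtain ⟨n, hn⟩ := (hT.2.2.eventually_gt_atTop t).exists
  exact key n ⟨hs, hst.trans hn.le⟩ ⟨ht, hn.le⟩ hst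

/-- Lowering the barrier from `m` to `n` raises the regulator of the lower start `u` at least as
much as that of the higher start `v`, and by at most `v - u` more in total. -/
theorem regulator_diff_bounds {u v m n : ℝ} (huv : u ≤ v) (hnm : n ≤ m) :
    max 0 (-(v + n)) - max 0 (-(u + n)) ≤ max 0 (-(v + m)) - max 0 (-(u + m)) ∧
      u - v ≤ max 0 (-(v + n)) - max 0 (-(u + n)) := by
  constructor <;> grind

theorem min_sub_min_bounds {z w : ℝ} (hzw : z ≤ w) (a : ℝ) :
    0 ≤ min w a - min z a ∧ min w a - min z a ≤ w - z := by
  constructor <;> grind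

section Comparison

variable {a : ℝ} {T : ℕ → ℝ} {f : ℝ → ℝ} {x y : ℝ} {U L R Ue Le Re : ℝ → ℝ}

theorem IsPCTriple.R_diff_bounds (hT : IsTimeGrid T) (hf : CadlagFun f)
    (h : IsPCTriple a T f x U L R) (he : IsPCTriple a T f y Ue Le Re) {k : ℕ}
    (hU : 0 ≤ U (T k)) (hUe : U (T k) ≤ Ue (T k)) {s t : ℝ}
    (hs : T k ≤ s) (hst : s ≤ t) (ht : t ≤ T (k + 1)) :
    Re t - R t ≤ Re s - R s ∧
      U (T k) - Ue (T k) ≤ (Re t - R t) - (Re (T k) - R (T k)) := by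
  rw [h.R_eq hT hf hU ⟨hs.trans hst, ht⟩, h.R_eq hT hf hU ⟨hs, hst.trans ht⟩,
    he.R_eq hT hf (hU.trans hUe) ⟨hs.trans hst, ht⟩,
    he.R_eq hT hf (hU.trans hUe) ⟨hs, hst.trans ht⟩]
  obtain ⟨h1, h2⟩ := regulator_diff_bounds hUe (hf.runInf_anti hs hst)
  constructor <;> linarith

/-- Between consecutive grid times, both the gap of `U` stays nonnegative and all gaps are
monotone. -/
theorem IsPCTriple.gap_bounds (hT : IsTimeGrid T) (hf : CadlagFun f)
    (h : IsPCTriple a T f x U L R) (he : IsPCTriple a T f y Ue Le Re) {k : ℕ}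
    (hU : 0 ≤ U (T k)) (hUe : U (T k) ≤ Ue (T k)) {s t : ℝ}
    (hs : T k ≤ s) (hst : s ≤ t) (ht : t ≤ T (k + 1)) :
    0 ≤ Ue t - U t ∧ Ue t - U t ≤ Ue s - U s ∧ Le s - L s ≤ Le t - L t := by
  have hR := R_diff_bounds hT hf h he hU hUe hs hst ht
  rcases ht.eq_or_lt with rfl | ht'
  · have hz := hR.2
    set z := (U (T k) + f (T (k + 1)) - f (T k)) + (R (T (k + 1)) - R (T k)) with hzdef
    set w := (Ue (T k) + f (T (k + 1)) - f (T k)) + (Re (T (k + 1)) - Re (T k)) with hwdef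
    have hzw : z ≤ w := by linarith
    have hmin := min_sub_min_bounds hzw a
    have hUj := h.U_jump k
    have hUej := he.U_jump k
    rw [← hzdef] at hUj
    rw [← hwdef] at hUej
    refine ⟨by linarith, ?_⟩
    rcases hst.eq_or_lt with rfl | hst'
    · exact ⟨le_rfl, le_rfl⟩
    have hLj := h.L_jump k
    have hLej := he.L_jump k
    rw [← hzdef] at hLj
    rw [← hwdef] at hLej
    have hmax : max (z - a) 0 ≤ max (w - a) 0 := max_le_max_right 0 (by linarith)
    rw [h.U_eq ⟨hs, hst'⟩, he.U_eq ⟨hs, hst'⟩, h.L_eq ⟨hs, hst'⟩, he.L_eq ⟨hs, hst'⟩]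
    constructor <;> linarith
  · have hs' := hst.trans_lt ht'
    rw [h.U_eq ⟨hs, hs'⟩, he.U_eq ⟨hs, hs'⟩, h.L_eq ⟨hs, hs'⟩, he.L_eq ⟨hs, hs'⟩,
      h.U_eq ⟨hs.trans hst, ht'⟩, he.U_eq ⟨hs.trans hst, ht'⟩,
      h.L_eq ⟨hs.trans hst, ht'⟩, he.L_eq ⟨hs.trans hst, ht'⟩]
    refine ⟨?_, ?_, le_rfl⟩ <;> linarith

theorem IsPCTriple.U_add_L_sub_R (hT : IsTimeGrid T) (hf0 : f 0 = 0) (hx : 0 ≤ x)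
    (h : IsPCTriple a T f x U L R) {t : ℝ} (ht : 0 ≤ t) : U t + L t - R t = x + f t := by
  have grid : ∀ k, U (T k) + L (T k) - R (T k) = x + f (T k) := by
    intro k
    induction k with
    | zero =>
      obtain ⟨h1, h2, h3⟩ := h.initial hT hf0 hx
      rw [h1, h2, h3, hT.1, hf0]
      ring
    | succ k ih =>
      have hmm (z : ℝ) : min z a + max (z - a) 0 = z := by grind
      have hU := h.U_jump k
      have hL := h.L_jump k
      have := hmm ((U (T k) + f (T (k + 1)) - f (T k)) + (R (T (k + 1)) - R (T k)))
      linarith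
  obtain ⟨k, hk⟩ := hT.exists_mem_Ico ht
  have := grid k
  rw [h.U_eq hk, h.L_eq hk]
  linarith

end Comparison

/-- Theorem 3.1: for `x ≥ 0` and `ε > 0`, (i) `t ↦ R⁽ˣ⁺ᵉ⁾ t - R⁽ˣ⁾ t` is non-increasing on
`[0,∞)` with values in `[-ε, 0]`; (ii) `t ↦ U⁽ˣ⁺ᵉ⁾ t - U⁽ˣ⁾ t` is non-increasing with values
in `[0, ε]`; (iii) `t ↦ L⁽ˣ⁺ᵉ⁾ t - L⁽ˣ⁾ t` is non-decreasing with values in `[0, ε]`. -/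
theorem stmt0
    (a : ℝ) (ha : 0 ≤ a) (T : ℕ → ℝ) (hT : IsTimeGrid T)
    (f : ℝ → ℝ) (hf : CadlagFun f) (hf0 : f 0 = 0)
    (hfT : ∀ k : ℕ, 1 ≤ k → ContinuousAt f (T k))
    (x ε : ℝ) (hx : 0 ≤ x) (hε : 0 < ε)
    (U L R Ue Le Re : ℝ → ℝ)
    (hx_triple : IsPCTriple a T f x U L R)
    (hxe_triple : IsPCTriple a T f (x + ε) Ue Le Re) :
    (AntitoneOn (fun t => Re t - R t) (Set.Ici 0) ∧
      ∀ t : ℝ, 0 ≤ t → Re t - R t ∈ Set.Icc (-ε) 0) ∧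
    (AntitoneOn (fun t => Ue t - U t) (Set.Ici 0) ∧
      ∀ t : ℝ, 0 ≤ t → Ue t - U t ∈ Set.Icc 0 ε) ∧
    (MonotoneOn (fun t => Le t - L t) (Set.Ici 0) ∧
      ∀ t : ℝ, 0 ≤ t → Le t - L t ∈ Set.Icc 0 ε) := by
  have hxε : 0 ≤ x + ε := by linarith
  have hU := hx_triple.U_grid_nonneg hT hf hf0 hx ha
  obtain ⟨hU0, hL0, hR0⟩ := hx_triple.initial hT hf0 hx
  obtain ⟨hUe0, hLe0, hRe0⟩ := hxe_triple.initial hT hf0 hxε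
  have hUe : ∀ k, U (T k) ≤ Ue (T k) := by
    intro k
    induction k with
    | zero => rw [hU0, hUe0]; linarith
    | succ k ih =>
      have hk := (hT.2.1 k.lt_succ_self).le
      exact sub_nonneg.1 (IsPCTriple.gap_bounds hT hf hx_triple hxe_triple (hU k) ih hk le_rfl
        le_rfl).1
  have hRanti : AntitoneOn (fun t => Re t - R t) (Ici 0) :=
    hT.antitoneOn_Ici fun k s hs t ht hst =>
      (IsPCTriple.R_diff_bounds hT hf hx_triple hxe_triple (hU k) (hUe k) hs.1 hst ht.2).1
  have hUanti : AntitoneOn (fun t => Ue t - U t) (Ici 0) :=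
    hT.antitoneOn_Ici fun k s hs t ht hst =>
      (IsPCTriple.gap_bounds hT hf hx_triple hxe_triple (hU k) (hUe k) hs.1 hst ht.2).2.1
  have hLanti : AntitoneOn (fun t => -(Le t - L t)) (Ici 0) :=
    hT.antitoneOn_Ici fun k s hs t ht hst => neg_le_neg
      (IsPCTriple.gap_bounds hT hf hx_triple hxe_triple (hU k) (hUe k) hs.1 hst ht.2).2.2
  rw [hT.1] at hU0 hL0 hR0 hUe0 hLe0 hRe0
  have hbounds : ∀ t, 0 ≤ t → Re t - R t ≤ 0 ∧ 0 ≤ Ue t - U t ∧ 0 ≤ Le t - L t ∧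
      (Ue t - U t) + (Le t - L t) - (Re t - R t) = ε := by
    intro t ht
    have h1 := hRanti self_mem_Ici ht ht
    have h2 := hLanti self_mem_Ici ht ht
    simp only [hR0, hRe0, hL0, hLe0, sub_self, neg_zero] at h1 h2
    obtain ⟨k, hk⟩ := hT.exists_mem_Ico ht
    have h3 := (IsPCTriple.gap_bounds hT hf hx_triple hxe_triple (hU k) (hUe k) hk.1 le_rfl
      hk.2.le).1
    have h4 := IsPCTriple.U_add_L_sub_R hT hf0 hx hx_triple ht
    have h5 := IsPCTriple.U_add_L_sub_R hT hf0 hxε hxe_triple ht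
    exact ⟨h1, h3, by linarith, by linarith⟩
  refine ⟨⟨hRanti, fun t ht => ?_⟩, ⟨hUanti, fun t ht => ?_⟩,
    ⟨fun s hs t ht hst => neg_le_neg_iff.1 (hLanti hs ht hst), fun t ht => ?_⟩⟩ <;>
  · obtain ⟨h1, h2, h3, h4⟩ := hbounds t ht
    constructor <;> linarith
end

section
/- For every x ≥ 0, if τ_0^{(x),−} < T_a^{(x),+}, then for all t ∈ [0, τ_0^{(x),−}) one has U^{(x)}(t) = x + f(t) and R^{(x)}(t) = 0; moreover τ_0^{(x),−} = inf{t ≥ 0 : R^{(x)}(t) > 0}. -/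
open Filter Set

/-- A càdlàg function is bounded below on compact sets. -/
theorem CadlagFun.bddBelow_image {f : ℝ → ℝ} (hf : CadlagFun f) {s : Set ℝ}
    (hs : IsCompact s) : BddBelow (f '' s) := by
  refine hs.induction_on (p := fun s => BddBelow (f '' s)) (by simp)
    (fun _ _ hst ht => ht.mono (image_mono hst))
    (fun _ _ hs ht => by rw [image_union]; exact hs.union ht) ?_
  intro t _
  obtain ⟨l, hl⟩ := hf.2 t
  have hleft : ∀ᶠ s in nhdsWithin t (Iio t), min (l - 1) (f t - 1) ≤ f s :=
    (hl.eventually (lt_mem_nhds (sub_one_lt l))).mono fun _ h => (min_le_left _ _).trans h.le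
  have hright : ∀ᶠ s in nhdsWithin t (Ici t), min (l - 1) (f t - 1) ≤ f s :=
    ((hf.1 t).eventually (lt_mem_nhds (sub_one_lt (f t)))).mono
      fun _ h => (min_le_right _ _).trans h.le
  have hnhds : ∀ᶠ s in nhds t, min (l - 1) (f t - 1) ≤ f s := by
    rw [← nhdsLT_sup_nhdsGE t]
    exact eventually_sup.2 ⟨hleft, hright⟩
  refine ⟨_, mem_nhdsWithin_of_mem_nhds hnhds, min (l - 1) (f t - 1), ?_⟩
  rintro _ ⟨s, hs, rfl⟩
  exact hs

/-- Every positive time lies in one of the intervals `(T k, T (k + 1)]`. -/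
theorem IsTimeGrid.exists_mem_Ioc {T : ℕ → ℝ} (hT : IsTimeGrid T) {t : ℝ} (ht : 0 < t) :
    ∃ k, T k < t ∧ t ≤ T (k + 1) := by
  classical
  have hex : ∃ k, t ≤ T k := (hT.2.2.eventually_ge_atTop t).exists
  obtain ⟨k, hk⟩ : ∃ k, Nat.find hex = k + 1 := by
    refine Nat.exists_eq_succ_of_ne_zero fun h => ?_
    have := Nat.find_spec hex
    rw [h, hT.1] at this
    linarith
  refine ⟨k, ?_, hk ▸ Nat.find_spec hex⟩
  exact not_le.1 (Nat.find_min hex (by omega))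

theorem IsTimeGrid.nonneg {T : ℕ → ℝ} (hT : IsTimeGrid T) (k : ℕ) : 0 ≤ T k :=
  hT.1 ▸ hT.2.1.monotone (Nat.zero_le k)

namespace IsPCTriple

variable {a : ℝ} {T : ℕ → ℝ} {f : ℝ → ℝ} {x : ℝ} {U L R : ℝ → ℝ}

theorem R_zero (h : IsPCTriple a T f x U L R) (hT : IsTimeGrid T) (hf0 : f 0 = 0)
    (hx : 0 ≤ x) : R 0 = 0 := by
  have h1 : 0 < T 1 := hT.1 ▸ hT.2.1 zero_lt_one
  simpa [hf0, hx] using h.R_first 0 le_rfl h1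

theorem U_zero (h : IsPCTriple a T f x U L R) (hT : IsTimeGrid T) (hf0 : f 0 = 0)
    (hx : 0 ≤ x) : U 0 = x := by
  have h1 : 0 < T 1 := hT.1 ▸ hT.2.1 zero_lt_one
  simpa [hf0, h.R_zero hT hf0 hx] using h.U_first 0 le_rfl h1

theorem R_eq_s1 (h : IsPCTriple a T f x U L R) {k : ℕ} {t : ℝ} (h1 : T k < t)
    (h2 : t ≤ T (k + 1)) : R t = R (T k) +
      max 0 (-sInf ((fun s => U (T k) + f s - f (T k)) '' Icc (T k) t)) := by
  rcases h2.lt_or_eq with h2 | rfl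
  · exact h.R_seg k t h1 h2
  · exact h.R_jump k

/-- At the grid times, the reflected path exceeds the free path by at most the regulator. -/
theorem U_sub_R_le (h : IsPCTriple a T f x U L R) (hT : IsTimeGrid T) (hf0 : f 0 = 0)
    (hx : 0 ≤ x) (k : ℕ) : U (T k) - R (T k) ≤ x + f (T k) := by
  induction k with
  | zero => simp [hT.1, hf0, h.R_zero hT hf0 hx, h.U_zero hT hf0 hx]
  | succ k ih =>
    have := (h.U_jump k).trans_le (min_le_left _ _)
    linarith

/-- The regulator at `0` is positive whenever the free path is negative. -/
theorem R_pos (h : IsPCTriple a T f x U L R) (hT : IsTimeGrid T) (hf : CadlagFun f)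
    (hf0 : f 0 = 0) (hx : 0 ≤ x) {t : ℝ} (ht : 0 ≤ t) (hneg : x + f t < 0) : 0 < R t := by
  have ht0 : 0 < t := by
    refine ht.lt_of_ne ?_
    rintro rfl
    linarith
  obtain ⟨k, h1, h2⟩ := hT.exists_mem_Ioc ht0
  have hbdd : BddBelow ((fun s => U (T k) + f s - f (T k)) '' Icc (T k) t) := by
    obtain ⟨m, hm⟩ := hf.bddBelow_image (isCompact_Icc (a := T k) (b := t))
    refine ⟨U (T k) + m - f (T k), ?_⟩
    rintro _ ⟨s, hs, rfl⟩
    have := hm (mem_image_of_mem f hs)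
    simp only
    linarith
  have hle := csInf_le hbdd ⟨t, ⟨h1.le, le_rfl⟩, rfl⟩
  have hmax := le_max_right 0 (-sInf ((fun s => U (T k) + f s - f (T k)) '' Icc (T k) t))
  have hR := h.R_eq_s1 h1 h2
  have hU := h.U_sub_R_le hT hf0 hx k
  simp only at hle
  linarith

/-- If no reflection occurred up to `T k`, the regulator stays zero while the free path is
nonnegative. -/
theorem R_eq_zero (h : IsPCTriple a T f x U L R) {k : ℕ} {t : ℝ} (h1 : T k < t)
    (h2 : t ≤ T (k + 1)) (hU : U (T k) = x + f (T k)) (hR : R (T k) = 0)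
    (hpos : ∀ s ∈ Icc (T k) t, 0 ≤ x + f s) : R t = 0 := by
  rw [h.R_eq_s1 h1 h2, hR, zero_add, max_eq_left]
  refine neg_nonpos.2 (Real.sInf_nonneg ?_)
  rintro _ ⟨s, hs, rfl⟩
  have := hpos s hs
  simp only
  linarith

/-- If the free path stays nonnegative up to `t` and does not exceed `a` at the grid times up to
`t`, then no reflection occurs up to time `t`. -/
theorem eq_free_path (h : IsPCTriple a T f x U L R) (hT : IsTimeGrid T) (hf0 : f 0 = 0)
    (hx : 0 ≤ x) {t : ℝ} (ht : 0 ≤ t) (hpos : ∀ s ∈ Icc 0 t, 0 ≤ x + f s)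
    (hle : ∀ k, 1 ≤ k → T k ≤ t → x + f (T k) ≤ a) : U t = x + f t ∧ R t = 0 := by
  have hgrid : ∀ k, T k ≤ t → U (T k) = x + f (T k) ∧ R (T k) = 0 := by
    intro k
    induction k with
    | zero => simp [hT.1, hf0, h.R_zero hT hf0 hx, h.U_zero hT hf0 hx]
    | succ k ih =>
      intro hk
      have hlt : T k < T (k + 1) := hT.2.1 k.lt_succ_self
      obtain ⟨hU, hR⟩ := ih (hlt.le.trans hk)
      have hR' := h.R_eq_zero hlt le_rfl hU hR
        fun s hs => hpos s ⟨(hT.nonneg k).trans hs.1, hs.2.trans hk⟩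
      have hka := hle (k + 1) (Nat.le_add_left 1 k) hk
      refine ⟨?_, hR'⟩
      rw [h.U_jump, hU, hR, hR', min_eq_left] <;> linarith
  rcases ht.eq_or_lt with rfl | ht0
  · simpa [hT.1] using hgrid 0 hT.1.le
  obtain ⟨k, h1, h2⟩ := hT.exists_mem_Ioc ht0
  rcases h2.lt_or_eq with h2 | rfl
  · obtain ⟨hU, hR⟩ := hgrid k h1.le
    have hR' := h.R_eq_zero h1 h2.le hU hR fun s hs => hpos s ⟨(hT.nonneg k).trans hs.1, hs.2⟩
    refine ⟨?_, hR'⟩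
    rw [h.U_seg k t h1 h2, hU, hR, hR']
    ring
  · exact hgrid _ le_rfl

end IsPCTriple

/-- If `τ_0^{(x),-} < T_a^{(x),+}`, then on `[0, τ_0^{(x),-})` one has `U⁽ˣ⁾ t = x + f t` and
`R⁽ˣ⁾ t = 0`; moreover `τ_0^{(x),-} = inf {t ≥ 0 : R⁽ˣ⁾ t > 0}`. -/
theorem stmt1
    (a : ℝ) (ha : 0 ≤ a) (T : ℕ → ℝ) (hT : IsTimeGrid T)
    (f : ℝ → ℝ) (hf : CadlagFun f) (hf0 : f 0 = 0)
    (hfT : ∀ k : ℕ, 1 ≤ k → ContinuousAt f (T k))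
    (x : ℝ) (hx : 0 ≤ x)
    (U L R : ℝ → ℝ)
    (hx_triple : IsPCTriple a T f x U L R)
    (horder : tauMinus f x < TPlus a T f x) :
    (∀ t : ℝ, 0 ≤ t → (t : EReal) < tauMinus f x → U t = x + f t ∧ R t = 0) ∧
    tauMinus f x = sInf ((fun t : ℝ => (t : EReal)) '' {t : ℝ | 0 ≤ t ∧ 0 < R t}) := by
  have hfree : ∀ t : ℝ, 0 ≤ t → (t : EReal) < tauMinus f x → U t = x + f t ∧ R t = 0 := by
    intro t ht htau
    refine hx_triple.eq_free_path hT hf0 hx ht ?_ ?_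
    · intro s hs
      by_contra! hneg
      have h1 : tauMinus f x ≤ (s : EReal) := sInf_le ⟨s, ⟨hs.1, hneg⟩, rfl⟩
      exact (htau.trans_le h1).not_ge (EReal.coe_le_coe_iff.2 hs.2)
    · intro k hk hkt
      by_contra! hgt
      have h1 : TPlus a T f x ≤ (T k : EReal) := sInf_le ⟨T k, ⟨k, hk, rfl, hgt⟩, rfl⟩
      exact ((htau.trans horder).trans_le h1).not_ge (EReal.coe_le_coe_iff.2 hkt)
  refine ⟨hfree, le_antisymm ?_ ?_⟩
  · refine le_sInf ?_
    rintro _ ⟨t, ⟨ht, hR⟩, rfl⟩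
    by_contra! hlt
    exact hR.ne' (hfree t ht hlt).2
  · exact sInf_le_sInf (image_mono fun t ht =>
      ⟨ht.1, hx_triple.R_pos hT hf hf0 hx ht.1 ht.2⟩)
end

section
/- For every x ≥ 0 and ε > 0, if τ_0^{(x),−} < T_a^{(x),+}, then inf{t > 0 : R^{(x+ε)}(t) − R^{(x)}(t) < 0} ≥ τ_0^{(x),−} (with inf ∅ := +∞); in particular R^{(x+ε)}(t) = R^{(x)}(t) for all t ∈ [0, τ_0^{(x),−}). -/
open Filter Set

/-- At grid times before the path `t ↦ x + f t` goes negative or exceeds `a` on the grid, a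
reflected path started at `y ≥ x` has not been pushed up and dominates `x + f`. -/
lemma IsPCTriple.grid_bound {a : ℝ} {T : ℕ → ℝ} {f : ℝ → ℝ} {x y t : ℝ} {U L R : ℝ → ℝ}
    (hT : IsTimeGrid T) (hf0 : f 0 = 0) (hx : 0 ≤ x) (hxy : x ≤ y)
    (h : IsPCTriple a T f y U L R)
    (hpos : ∀ s, 0 ≤ s → s ≤ t → 0 ≤ x + f s)
    (hle : ∀ k, 1 ≤ k → T k ≤ t → x + f (T k) ≤ a) (k : ℕ) (hk : T k ≤ t) :
    R (T k) = 0 ∧ x + f (T k) ≤ U (T k) := by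
  obtain ⟨hT0, hmono, -⟩ := hT
  have hT1 : 0 < T 1 := hT0 ▸ hmono zero_lt_one
  induction k with
  | zero =>
    have hR0 : R 0 = 0 := by
      rw [h.R_first 0 le_rfl hT1]
      simp [hf0, hx.trans hxy]
    rw [hT0]
    refine ⟨hR0, ?_⟩
    rw [h.U_first 0 le_rfl hT1, hR0]
    linarith
  | succ k ih =>
    have hlt : T k < T (k + 1) := hmono k.lt_succ_self
    obtain ⟨hR, hU⟩ := ih (hlt.le.trans hk)
    have hk0 : 0 ≤ T k := hT0 ▸ hmono.monotone k.zero_le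
    have hinf : 0 ≤ sInf ((fun s => U (T k) + f s - f (T k)) '' Icc (T k) (T (k + 1))) := by
      refine Real.sInf_nonneg ?_
      rintro _ ⟨s, hs, rfl⟩
      have := hpos s (hk0.trans hs.1) (hs.2.trans hk)
      dsimp only
      linarith
    have hR' : R (T (k + 1)) = 0 := by
      rw [h.R_jump k, hR, max_eq_left (neg_nonpos.mpr hinf), add_zero]
    refine ⟨hR', ?_⟩
    rw [h.U_jump k, hR', hR]
    exact le_min (by linarith) (hle (k + 1) (Nat.le_add_left 1 k) hk)

/-- A reflected path started at `y ≥ x` is not pushed up before the path `t ↦ x + f t` goes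
negative or exceeds `a` on the grid. -/
lemma IsPCTriple.R_eq_zero_s5 {a : ℝ} {T : ℕ → ℝ} {f : ℝ → ℝ} {x y t : ℝ} {U L R : ℝ → ℝ}
    (hT : IsTimeGrid T) (hf0 : f 0 = 0) (hx : 0 ≤ x) (hxy : x ≤ y)
    (h : IsPCTriple a T f y U L R) (ht : 0 ≤ t)
    (hpos : ∀ s, 0 ≤ s → s ≤ t → 0 ≤ x + f s)
    (hle : ∀ k, 1 ≤ k → T k ≤ t → x + f (T k) ≤ a) : R t = 0 := by
  obtain ⟨k, hk, hk'⟩ : ∃ k, T k ≤ t ∧ t < T (k + 1) := by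
    by_contra! hcon
    have hall : ∀ k, T k ≤ t := fun k => by
      induction k with
      | zero => exact hT.1.trans_le ht
      | succ k ih => exact hcon k ih
    obtain ⟨k, hk⟩ := (hT.2.2.eventually_gt_atTop t).exists
    exact (hall k).not_gt hk
  obtain ⟨hR, hU⟩ := h.grid_bound hT hf0 hx hxy hpos hle k hk
  rcases hk.eq_or_lt with rfl | hlt
  · exact hR
  have hk0 : 0 ≤ T k := hT.1 ▸ hT.2.1.monotone k.zero_le
  have hinf : 0 ≤ sInf ((fun s => U (T k) + f s - f (T k)) '' Icc (T k) t) := by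
    refine Real.sInf_nonneg ?_
    rintro _ ⟨s, hs, rfl⟩
    have := hpos s (hk0.trans hs.1) hs.2
    dsimp only
    linarith
  rw [h.R_seg k t hlt hk', hR, max_eq_left (neg_nonpos.mpr hinf), add_zero]

/-- If `τ_0^{(x),-} < T_a^{(x),+}`, then
`inf {t > 0 : R⁽ˣ⁺ᵉ⁾ t - R⁽ˣ⁾ t < 0} ≥ τ_0^{(x),-}` (with `inf ∅ = +∞`);
in particular `R⁽ˣ⁺ᵉ⁾ t = R⁽ˣ⁾ t` for all `t ∈ [0, τ_0^{(x),-})`. -/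
theorem stmt5
    (a : ℝ) (ha : 0 ≤ a) (T : ℕ → ℝ) (hT : IsTimeGrid T)
    (f : ℝ → ℝ) (hf : CadlagFun f) (hf0 : f 0 = 0)
    (hfT : ∀ k : ℕ, 1 ≤ k → ContinuousAt f (T k))
    (x ε : ℝ) (hx : 0 ≤ x) (hε : 0 < ε)
    (U L R Ue Le Re : ℝ → ℝ)
    (hx_triple : IsPCTriple a T f x U L R)
    (hxe_triple : IsPCTriple a T f (x + ε) Ue Le Re)
    (horder : tauMinus f x < TPlus a T f x) :
    tauMinus f x ≤
      sInf ((fun t : ℝ => (t : EReal)) '' {t : ℝ | 0 < t ∧ Re t - R t < 0}) ∧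
    ∀ t : ℝ, 0 ≤ t → (t : EReal) < tauMinus f x → Re t = R t := by
  have heq : ∀ t : ℝ, 0 ≤ t → (t : EReal) < tauMinus f x → Re t = R t := by
    intro t ht htau
    have hpos : ∀ s, 0 ≤ s → s ≤ t → 0 ≤ x + f s := by
      intro s hs hst
      by_contra! hneg
      have : tauMinus f x ≤ (s : EReal) := sInf_le ⟨s, ⟨hs, hneg⟩, rfl⟩
      exact (this.trans (EReal.coe_le_coe_iff.mpr hst)).not_gt htau
    have hle : ∀ k, 1 ≤ k → T k ≤ t → x + f (T k) ≤ a := by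
      intro k hk hkt
      by_contra! hgt
      have : TPlus a T f x ≤ (T k : EReal) := sInf_le ⟨T k, ⟨k, hk, rfl, hgt⟩, rfl⟩
      exact (this.trans (EReal.coe_le_coe_iff.mpr hkt)).not_gt (htau.trans horder)
    rw [hx_triple.R_eq_zero_s5 hT hf0 hx le_rfl ht hpos hle,
      hxe_triple.R_eq_zero_s5 hT hf0 hx (by linarith) ht hpos hle]
  refine ⟨le_sInf ?_, heq⟩
  rintro _ ⟨t, ⟨ht, hneg⟩, rfl⟩
  by_contra! hlt
  have := heq t ht.le hlt
  linarith
end
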